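/- If S is a 𝒞-derivation step from a clause set N to a clause set N' which is not a purified clause deletion step (i.e. S is an inference step Res, Fac or ConstrElim, a redundancy elimination step, or an extended purity deletion step), then N[X̄ ← T'_S] ⟺ N'. -/

import Mathlib

/- Common framework: first-order clause logic with equality, predicate symbols and
predicate variables; Tarskian semantics; the constraint resolution calculus 𝒞 of the
SCAN algorithm; resolution closures and the closure predicate Res^p_P; semantic
substitution of predicate expressions for predicate variables and witnesses for
second-order quantifier elimination. -/

namespace Scan

/-- First-order terms: individual variables, parameters (used as "fresh constants" c̄)
and function applications (constants are 0-ary functions). -/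
inductive Trm : Type
  | var : ℕ → Trm
  | param : ℕ → Trm
  | fn : ℕ → List Trm → Trm

/-- Atoms: equations, predicate-symbol atoms and predicate-variable atoms. -/
inductive Atm : Type
  | eq : Trm → Trm → Atm
  | pred : ℕ → List Trm → Atm
  | pvar : ℕ → List Trm → Atm

/-- A literal is a signed atom (`pos = true` for positive literals). -/
structure Lit : Type where
  pos : Bool
  atom : Atm

/-- The dual of a literal. -/
def Lit.dual (l : Lit) : Lit := ⟨!l.pos, l.atom⟩

/-- A clause is a multiset (disjunction) of literals, implicitly universally closed. -/
abbrev Clause := Multiset Lit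

/-- A pointed clause: a clause with a designated literal. -/
structure PClause : Type where
  lit : Lit
  rest : Clause

/-- The clause underlying a pointed clause. -/
def PClause.toClause (P : PClause) : Clause := P.lit ::ₘ P.rest

/-- A pointed clause is `X`-pointed if its designated literal is an `X`-literal. -/
def PClause.IsPointedAt (P : PClause) (X : ℕ) : Prop :=
  ∃ ts, P.lit.atom = Atm.pvar X ts

/-- The predicate variable of the designated literal, if any. -/
def pvarOf (P : PClause) : Option ℕ :=
  match P.lit.atom with
  | .pvar X _ => some X
  | _ => none

/-- Tarskian structures (with equality interpreted as identity); `par` interprets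
the parameters (fresh constants). -/
structure Str : Type 1 where
  dom : Type
  inh : Nonempty dom
  fn : ℕ → List dom → dom
  par : ℕ → dom
  pred : ℕ → List dom → Prop

/-- An assignment of the (free) predicate variables over a domain. -/
abbrev PredAssign (D : Type) := ℕ → List D → Prop

def evalTrm (M : Str) (v : ℕ → M.dom) : Trm → M.dom
  | .var n => v n
  | .param n => M.par n
  | .fn f ts => M.fn f (ts.attach.map fun t => evalTrm M v t.1)
decreasing_by
  have := List.sizeOf_lt_of_mem t.2
  simp only [Trm.fn.sizeOf_spec]
  omega

def Atm.terms : Atm → List Trm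
  | .eq t s => [t, s]
  | .pred _ ts => ts
  | .pvar _ ts => ts

def evalAtm (M : Str) (ρ : PredAssign M.dom) (v : ℕ → M.dom) : Atm → Prop
  | .eq t s => evalTrm M v t = evalTrm M v s
  | .pred p ts => M.pred p (ts.map (evalTrm M v))
  | .pvar X ts => ρ X (ts.map (evalTrm M v))

def evalLit (M : Str) (ρ : PredAssign M.dom) (v : ℕ → M.dom) (l : Lit) : Prop :=
  if l.pos then evalAtm M ρ v l.atom else ¬ evalAtm M ρ v l.atom

def evalClause (M : Str) (ρ : PredAssign M.dom) (v : ℕ → M.dom) (C : Clause) : Prop :=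
  ∃ l ∈ C, evalLit M ρ v l

/-- Truth of a (universally closed) clause. -/
def clauseTrue (M : Str) (ρ : PredAssign M.dom) (C : Clause) : Prop :=
  ∀ v : ℕ → M.dom, evalClause M ρ v C

/-- Truth of a clause set (universal closure of the conjunction of its clauses). -/
def setTrue (M : Str) (ρ : PredAssign M.dom) (N : Set Clause) : Prop :=
  ∀ C ∈ N, clauseTrue M ρ C

/-- Semantic entailment `N ⇛ N'` between clause sets: validity of the implication,
i.e. it holds in every structure under every assignment of the free predicate
variables. -/
def Entails (N N' : Set Clause) : Prop :=
  ∀ (M : Str) (ρ : PredAssign M.dom), setTrue M ρ N → setTrue M ρ N'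

/-- Logical equivalence of clause sets. -/
def EquivSets (N N' : Set Clause) : Prop :=
  ∀ (M : Str) (ρ : PredAssign M.dom), setTrue M ρ N ↔ setTrue M ρ N'

/-! ### Substitutions and unification -/

abbrev Subst := ℕ → Trm

def substTrm (σ : Subst) : Trm → Trm
  | .var n => σ n
  | .param n => .param n
  | .fn f ts => .fn f (ts.attach.map fun t => substTrm σ t.1)
decreasing_by
  have := List.sizeOf_lt_of_mem t.2
  simp only [Trm.fn.sizeOf_spec]
  omega

def substAtm (σ : Subst) : Atm → Atm
  | .eq t s => .eq (substTrm σ t) (substTrm σ s)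
  | .pred p ts => .pred p (ts.map (substTrm σ))
  | .pvar X ts => .pvar X (ts.map (substTrm σ))

def substLit (σ : Subst) (l : Lit) : Lit := ⟨l.pos, substAtm σ l.atom⟩

def substClause (σ : Subst) (C : Clause) : Clause := C.map (substLit σ)

/-- `σ` unifies the tuples of terms `ts` and `ss` componentwise. -/
def IsUnifier (σ : Subst) (ts ss : List Trm) : Prop :=
  ts.map (substTrm σ) = ss.map (substTrm σ)

def compSubst (σ τ : Subst) : Subst := fun n => substTrm τ (σ n)

/-- `σ` is a most general unifier of `ts` and `ss`. -/
def IsMGU (σ : Subst) (ts ss : List Trm) : Prop :=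
  IsUnifier σ ts ss ∧ ∀ τ, IsUnifier τ ts ss → ∃ ρ, τ = compSubst σ ρ

/-- A term contains a parameter. -/
inductive HasParam : Trm → Prop
  | param (n : ℕ) : HasParam (.param n)
  | fn {f : ℕ} {ts : List Trm} {t : Trm} : t ∈ ts → HasParam t → HasParam (.fn f ts)

/-- A clause is parameter-free (so the parameters are "fresh constants" for it). -/
def paramFree (C : Clause) : Prop :=
  ∀ l ∈ C, ∀ t ∈ l.atom.terms, ¬ HasParam t

def paramFreeSet (N : Set Clause) : Prop := ∀ C ∈ N, paramFree C

/-! ### The inference rules of SCAN -/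

/-- The constraint `t̄ ≉ s̄` as a list of disequation literals. -/
def neqLits (ts ss : List Trm) : List Lit :=
  (ts.zip ss).map fun p => ⟨false, .eq p.1 p.2⟩

/-- Constraint resolution upon an `X̄`-literal, `X̄` given as the set `Xs`:
from `C ∨ L(t̄)` and `D ∨ L(s̄)^⊥` infer `t̄ ≉ s̄ ∨ C ∨ D`. -/
def IsResolvent (Xs : Set ℕ) (C D R : Clause) : Prop :=
  ∃ (b : Bool) (X : ℕ) (ts ss : List Trm) (C' D' : Clause),
    X ∈ Xs ∧ ts.length = ss.length ∧
    C = (⟨b, .pvar X ts⟩ : Lit) ::ₘ C' ∧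
    D = (⟨!b, .pvar X ss⟩ : Lit) ::ₘ D' ∧
    R = ↑(neqLits ts ss) + C' + D'

/-- Constraint factoring upon `X̄`-literals: from `C ∨ L(t̄) ∨ L(s̄)` infer
`t̄ ≉ s̄ ∨ C ∨ L(t̄)`. -/
def IsFactor (Xs : Set ℕ) (C R : Clause) : Prop :=
  ∃ (b : Bool) (X : ℕ) (ts ss : List Trm) (C' : Clause),
    X ∈ Xs ∧ ts.length = ss.length ∧
    C = (⟨b, .pvar X ts⟩ : Lit) ::ₘ (⟨b, .pvar X ss⟩ : Lit) ::ₘ C' ∧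
    R = ↑(neqLits ts ss) + ((⟨b, .pvar X ts⟩ : Lit) ::ₘ C')

/-- Constraint elimination: from `t̄ ≉ s̄ ∨ C` infer `Cσ` for `σ` a most general
unifier of `t̄` and `s̄`. -/
def IsConstrElim (C R : Clause) : Prop :=
  ∃ (ts ss : List Trm) (C' : Clause) (σ : Subst),
    C = ↑(neqLits ts ss) + C' ∧ IsMGU σ ts ss ∧ R = substClause σ C'

/-- A resolvent between the clause `D` and the pointed clause `P` upon the
designated literal of `P`. -/
def IsPResolvent (P : PClause) (D R : Clause) : Prop :=
  ∃ (b : Bool) (X : ℕ) (ts ss : List Trm) (D' : Clause),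
    P.lit = ⟨b, .pvar X ts⟩ ∧ ts.length = ss.length ∧
    D = (⟨!b, .pvar X ss⟩ : Lit) ::ₘ D' ∧
    R = ↑(neqLits ts ss) + P.rest + D'

/-! ### Resolution closures and the closure predicate `Res^p_P` -/

/-- `Res_P(M)`: the smallest set of clauses containing `M` and closed under
resolvents with `P` upon the designated literal of `P`. -/
inductive InResClo (P : PClause) (M : Set Clause) : Clause → Prop
  | base {C : Clause} : C ∈ M → InResClo P M C
  | step {C R : Clause} : InResClo P M C → IsPResolvent P C R → InResClo P M R

def ResClo (P : PClause) (M : Set Clause) : Set Clause := {C | InResClo P M C}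

/-- The tuple of fresh constants `c̄ = (c₀, …, c_{k-1})` as parameters. -/
def cparams (k : ℕ) : List Trm := (List.range k).map Trm.param

/-- `Res^U_P(c̄) = Res_P({L(c̄)^⊥})`, where `L(t̄)` is the designated literal of `P`
and `c̄` is the tuple of fresh constants (parameters). -/
def ResU (P : PClause) : Set Clause :=
  {C | ∃ X ts, P.lit.atom = Atm.pvar X ts ∧
      InResClo P {((⟨!P.lit.pos, Atm.pvar X (cparams ts.length)⟩ : Lit) ::ₘ (0 : Clause))} C}

/-- Reinterpret the parameters `c̄` as the tuple `ds` of domain elements. -/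
def withPar (M : Str) (ds : List M.dom) : Str :=
  { M with par := fun n => ds.getD n (M.par n) }

/-- The (possibly infinitary) closure predicate `Res^p_P`, given semantically: its
value on a structure `M`, an assignment `ρ` of the predicate variables and a tuple
`ds` of arguments (the values of the λ-abstracted variables `ū`, substituted for
the fresh constants `c̄`).  For a negative designated literal it is
`λū.⋀_{C'∈Res^U_P(c̄)} ∀v̄ C'(ū,v̄)`, for a positive one
`λū.⋁_{C'∈Res^U_P(c̄)} ∃v̄ ¬C'(ū,v̄)`. -/
def ResPred (P : PClause) (M : Str) (ρ : PredAssign M.dom) (ds : List M.dom) : Prop :=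
  if P.lit.pos then
    ∃ C ∈ ResU P, ∃ v : ℕ → M.dom, ¬ evalClause (withPar M ds) ρ v C
  else
    ∀ C ∈ ResU P, ∀ v : ℕ → M.dom, evalClause (withPar M ds) ρ v C

/-! ### Semantic substitution of predicate expressions and witnesses -/

/-- Update a predicate assignment at the single predicate variable `X`. -/
def updP1 {D : Type} (ρ : PredAssign D) (X : ℕ) (Q : List D → Prop) : PredAssign D :=
  fun Y => if Y = X then Q else ρ Y

/-- Update a predicate assignment simultaneously at the tuple `X̄ = Xs` (assumed
injective) of predicate variables.  This realizes the simultaneous substitution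
`[X̄ ← ᾱ]` semantically. -/
def updP {D : Type} {d : ℕ} (ρ : PredAssign D) (Xs : Fin d → ℕ)
    (Ps : Fin d → List D → Prop) : PredAssign D :=
  fun Y ds => (∃ i, Xs i = Y ∧ Ps i ds) ∨ ((∀ i, Xs i ≠ Y) ∧ ρ Y ds)

/-- A (possibly infinitary, possibly second-order) predicate expression, given by
its semantics: for every structure and assignment of the free predicate variables,
a predicate on tuples of domain elements. -/
abbrev SemPred : Type 1 := (M : Str) → PredAssign M.dom → List M.dom → Prop

/-- `ᾱ = αs` is an (elimination) witness for `∃X̄ N`: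
`∃X̄ N ⟺ N[X̄ ← ᾱ]`, where the substitution is taken semantically. -/
def IsWitness {d : ℕ} (Xs : Fin d → ℕ) (αs : Fin d → SemPred) (N : Set Clause) : Prop :=
  ∀ (M : Str) (ρ : PredAssign M.dom),
    (∃ Ps : Fin d → List M.dom → Prop, setTrue M (updP ρ Xs Ps) N) ↔
      setTrue M (updP ρ Xs (fun i => αs i M ρ)) N

/-- Logical equivalence `∃X̄ N ⟺ ∃X̄ N'`. -/
def ExEquiv {d : ℕ} (Xs : Fin d → ℕ) (N N' : Set Clause) : Prop :=
  ∀ (M : Str) (ρ : PredAssign M.dom),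
    (∃ Ps : Fin d → List M.dom → Prop, setTrue M (updP ρ Xs Ps) N) ↔
      (∃ Ps : Fin d → List M.dom → Prop, setTrue M (updP ρ Xs Ps) N')

/-! ### Occurrences of predicate variables -/

/-- `X` occurs in `C` with polarity `b`. -/
def OccursPol (X : ℕ) (b : Bool) (C : Clause) : Prop :=
  ∃ l ∈ C, l.pos = b ∧ ∃ ts, l.atom = Atm.pvar X ts

/-- `X` occurs in `C`. -/
def OccursIn (X : ℕ) (C : Clause) : Prop := ∃ b, OccursPol X b C

/-- An `X`-pointed clause is one-sided if `X` occurs in it only with the polarity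
of the designated literal. -/
def OneSided (P : PClause) : Prop :=
  ∀ X ts, P.lit.atom = Atm.pvar X ts →
    ∀ l ∈ P.rest, ∀ ss, l.atom = Atm.pvar X ss → l.pos = P.lit.pos

/-! ### The calculus 𝒞 -/

/-- The derivation steps of the constraint resolution calculus 𝒞 (with the data
determining them). -/
inductive CStep : Type
  | res (C D R : Clause)
  | fac (C R : Clause)
  | celim (C R : Clause)
  | redElim (C : Clause)
  | extPurDel (X : ℕ) (b : Bool)
  | purDel (P : PClause)

/-- Side conditions for a 𝒞-derivation step from the clause set `N`; `Xs` is the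
set of existentially quantified predicate variables `X̄` and `Red C N` is the
ambient redundancy notion ("`C` is redundant in `N`"). -/
def CStep.ok (Xs : Set ℕ) (Red : Clause → Set Clause → Prop) (N : Set Clause) :
    CStep → Prop
  | .res C D R => C ∈ N ∧ D ∈ N ∧ IsResolvent Xs C D R
  | .fac C R => C ∈ N ∧ IsFactor Xs C R
  | .celim C R => C ∈ N ∧ IsConstrElim C R
  | .redElim C => C ∈ N ∧ Red C N
  | .extPurDel X b => X ∈ Xs ∧ ∀ C ∈ N, OccursIn X C → OccursPol X b C
  | .purDel P => (∃ X ∈ Xs, P.IsPointedAt X) ∧ P.toClause ∈ N ∧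
      ∀ D ∈ N \ {P.toClause}, ∀ R, IsPResolvent P D R → Red R (N \ {P.toClause})

/-- The conclusion of a 𝒞-derivation step. -/
def CStep.apply (N : Set Clause) : CStep → Set Clause
  | .res _ _ R => N ∪ {R}
  | .fac _ R => N ∪ {R}
  | .celim _ R => N ∪ {R}
  | .redElim C => N \ {C}
  | .extPurDel X _ => {C ∈ N | ¬ OccursIn X C}
  | .purDel P => N \ {P.toClause}

/-- Redundancy is compatible with entailment: a redundant clause is entailed. -/
def RedCompat (Red : Clause → Set Clause → Prop) : Prop :=
  ∀ C N, Red C N →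
    ∀ (M : Str) (ρ : PredAssign M.dom), setTrue M ρ N → clauseTrue M ρ C

/-- Redundancy elimination is equivalence-preserving. -/
def RedEquiv (Red : Clause → Set Clause → Prop) : Prop :=
  ∀ C N, C ∈ N → Red C N →
    ∀ (M : Str) (ρ : PredAssign M.dom), (setTrue M ρ (N \ {C}) ↔ setTrue M ρ N)

/-! ### Derivations and the witness transformation -/

/-- All steps of the derivation `D` from `N` satisfy their side conditions. -/
def derivOK (Xs : Set ℕ) (Red : Clause → Set Clause → Prop) :
    Set Clause → List CStep → Prop
  | _, [] => True
  | N, S :: D => CStep.ok Xs Red N S ∧ derivOK Xs Red (CStep.apply N S) D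

/-- The conclusion of the derivation `D` from `N`. -/
def applyDeriv : Set Clause → List CStep → Set Clause
  | N, [] => N
  | N, S :: D => applyDeriv (CStep.apply N S) D

/-- The witness transformation `T_S`: identity for inference and redundancy
elimination steps, `λū.⊤` resp. `λū.⊥` at the `X`-component for extended purity
deletion, and `Res^p_P[X̄ ← ᾱ]` at the `X_i`-component for deletion of the purified
`X_i`-pointed clause `P`. -/
def Twit {d : ℕ} (Xs : Fin d → ℕ) (S : CStep) (αs : Fin d → SemPred) :
    Fin d → SemPred :=
  match S with
  | .extPurDel X b =>
      fun i => if Xs i = X then (fun _M _ρ _ds => b = true) else αs i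
  | .purDel P =>
      fun i => if pvarOf P = some (Xs i) then
          (fun M ρ ds => ResPred P M (updP ρ Xs (fun j => αs j M ρ)) ds)
        else αs i
  | _ => αs

/-- `wit(D)` constructed backwards from the base (placeholder) witness:
`wit_m = base`, `wit_{i-1} = T_{D_i}(wit_i)`. -/
def witDeriv {d : ℕ} (Xs : Fin d → ℕ) (base : Fin d → SemPred) (D : List CStep) :
    Fin d → SemPred :=
  D.foldr (fun S acc => Twit Xs S acc) base

/-- The transformation `T'_S` (predicate-variable form of `T_S`), given
semantically: the tuple of predicates substituted for `X̄`. -/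
def TPrime {d : ℕ} (Xs : Fin d → ℕ) (S : CStep) (M : Str) (ρ : PredAssign M.dom) :
    Fin d → List M.dom → Prop :=
  match S with
  | .extPurDel X b => fun i => if Xs i = X then (fun _ => b = true) else ρ (Xs i)
  | .purDel P => fun i => if pvarOf P = some (Xs i) then ResPred P M ρ else ρ (Xs i)
  | _ => fun i => ρ (Xs i)

theorem updP_apply_self {D : Type} {d : ℕ} (ρ : PredAssign D) (Xs : Fin d → ℕ) :
    updP ρ Xs (fun i => ρ (Xs i)) = ρ := by
  funext Y ds
  apply propext
  constructor
  · rintro (⟨i, rfl, h⟩ | ⟨-, h⟩) <;> exact h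
  · intro h
    by_cases hY : ∃ i, Xs i = Y
    · obtain ⟨i, rfl⟩ := hY
      exact Or.inl ⟨i, rfl, h⟩
    · exact Or.inr ⟨fun i hi => hY ⟨i, hi⟩, h⟩

theorem updP_ite_eq_updP1 {D : Type} {d : ℕ} (ρ : PredAssign D) (Xs : Fin d → ℕ) {X : ℕ}
    (hX : X ∈ Set.range Xs) (Q : List D → Prop) :
    updP ρ Xs (fun i => if Xs i = X then Q else ρ (Xs i)) = updP1 ρ X Q := by
  rw [← updP_apply_self (updP1 ρ X Q) Xs]
  funext Y ds
  have hY : (∀ i, Xs i ≠ Y) → updP1 ρ X Q Y = ρ Y := by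
    intro h
    obtain ⟨i, rfl⟩ := hX
    exact if_neg fun e => h i e.symm
  apply propext
  constructor
  · rintro (h | ⟨h, h'⟩)
    · exact Or.inl h
    · exact Or.inr ⟨h, by rwa [hY h]⟩
  · rintro (h | ⟨h, h'⟩)
    · exact Or.inl h
    · exact Or.inr ⟨h, by rwa [hY h] at h'⟩

theorem evalTrm_substTrm (M : Str) (v : ℕ → M.dom) (σ : Subst) (t : Trm) :
    evalTrm M v (substTrm σ t) = evalTrm M (fun n => evalTrm M v (σ n)) t := by
  match t with
  | .var n => simp [substTrm, evalTrm]
  | .param n => simp [substTrm, evalTrm]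
  | .fn f ts =>
    have ih : ∀ t ∈ ts, evalTrm M v (substTrm σ t) =
        evalTrm M (fun n => evalTrm M v (σ n)) t :=
      fun t ht => evalTrm_substTrm M v σ t
    simp only [substTrm, evalTrm, List.map_subtype, List.unattach_attach,
      List.map_map]
    congr 1
    exact List.map_congr_left ih
termination_by t
decreasing_by
  have := List.sizeOf_lt_of_mem ht
  simp only [Trm.fn.sizeOf_spec]
  omega

theorem evalLit_substLit (M : Str) (ρ : PredAssign M.dom) (v : ℕ → M.dom) (σ : Subst) (l : Lit) :
    evalLit M ρ v (substLit σ l) ↔ evalLit M ρ (fun n => evalTrm M v (σ n)) l := by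
  obtain ⟨b, a⟩ := l
  cases a <;>
    simp [evalLit, substLit, substAtm, evalAtm, evalTrm_substTrm, Function.comp_def]

theorem evalClause_add {M : Str} {ρ : PredAssign M.dom} {v : ℕ → M.dom} {C D : Clause} :
    evalClause M ρ v (C + D) ↔ evalClause M ρ v C ∨ evalClause M ρ v D := by
  simp only [evalClause, Multiset.mem_add, or_and_right, exists_or]

theorem evalClause_cons {M : Str} {ρ : PredAssign M.dom} {v : ℕ → M.dom} {l : Lit} {C : Clause} :
    evalClause M ρ v (l ::ₘ C) ↔ evalLit M ρ v l ∨ evalClause M ρ v C := by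
  simp [evalClause]

theorem evalClause_neqLits_iff {M : Str} {ρ : PredAssign M.dom} {v : ℕ → M.dom}
    {ts ss : List Trm} (h : ts.length = ss.length) :
    evalClause M ρ v (neqLits ts ss) ↔ ts.map (evalTrm M v) ≠ ss.map (evalTrm M v) := by
  induction ts generalizing ss with
  | nil =>
    cases ss with
    | nil => simp [evalClause, neqLits]
    | cons s ss => simp at h
  | cons t ts ih =>
    cases ss with
    | nil => simp at h
    | cons s ss =>
      have hcons : ((neqLits (t :: ts) (s :: ss) : List Lit) : Clause) =
          (⟨false, .eq t s⟩ : Lit) ::ₘ (neqLits ts ss : Clause) := rfl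
      rw [hcons, evalClause_cons, ih (by simpa using h)]
      simp only [evalLit, evalAtm, List.map_cons, ne_eq, List.cons.injEq, not_and_or]
      simp

theorem IsResolvent.evalClause {Xs : Set ℕ} {C D R : Clause} (h : IsResolvent Xs C D R)
    {M : Str} {ρ : PredAssign M.dom} {v : ℕ → M.dom}
    (hC : evalClause M ρ v C) (hD : evalClause M ρ v D) : evalClause M ρ v R := by
  obtain ⟨b, X, ts, ss, C', D', -, hlen, rfl, rfl, rfl⟩ := h
  rw [evalClause_cons] at hC hD
  rw [evalClause_add, evalClause_add, evalClause_neqLits_iff hlen]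
  by_cases he : ts.map (evalTrm M v) = ss.map (evalTrm M v)
  · have : ¬ (evalLit M ρ v ⟨b, .pvar X ts⟩ ∧ evalLit M ρ v ⟨!b, .pvar X ss⟩) := by
      cases b <;> simp [evalLit, evalAtm, he]
    tauto
  · exact Or.inl (Or.inl he)

theorem IsFactor.evalClause {Xs : Set ℕ} {C R : Clause} (h : IsFactor Xs C R)
    {M : Str} {ρ : PredAssign M.dom} {v : ℕ → M.dom}
    (hC : evalClause M ρ v C) : evalClause M ρ v R := by
  obtain ⟨b, X, ts, ss, C', -, hlen, rfl, rfl⟩ := h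
  rw [evalClause_cons, evalClause_cons] at hC
  rw [evalClause_add, evalClause_cons, evalClause_neqLits_iff hlen]
  by_cases he : ts.map (evalTrm M v) = ss.map (evalTrm M v)
  · have : evalLit M ρ v ⟨b, .pvar X ss⟩ → evalLit M ρ v ⟨b, .pvar X ts⟩ := by
      simp [evalLit, evalAtm, he]
    tauto
  · exact Or.inl he

theorem evalClause_substClause (M : Str) (ρ : PredAssign M.dom) (v : ℕ → M.dom) (σ : Subst)
    (C : Clause) :
    evalClause M ρ v (substClause σ C) ↔ evalClause M ρ (fun n => evalTrm M v (σ n)) C := by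
  simp [evalClause, substClause, evalLit_substLit]

theorem IsConstrElim.clauseTrue {C R : Clause} (h : IsConstrElim C R)
    {M : Str} {ρ : PredAssign M.dom} (hC : clauseTrue M ρ C) : clauseTrue M ρ R := by
  obtain ⟨ts, ss, C', σ, rfl, ⟨hσ, -⟩, rfl⟩ := h
  intro v
  have hlen : ts.length = ss.length := by simpa using congrArg List.length hσ
  have hmap : ts.map (evalTrm M fun n => evalTrm M v (σ n)) =
      ss.map (evalTrm M fun n => evalTrm M v (σ n)) := by
    simpa [Function.comp_def, evalTrm_substTrm] using congrArg (List.map (evalTrm M v)) hσ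
  rw [evalClause_substClause]
  exact (evalClause_add.1 (hC _)).resolve_left fun h => (evalClause_neqLits_iff hlen).1 h hmap

theorem setTrue_union_singleton_iff {M : Str} {ρ : PredAssign M.dom} {N : Set Clause} {R : Clause}
    (h : setTrue M ρ N → clauseTrue M ρ R) : setTrue M ρ N ↔ setTrue M ρ (N ∪ {R}) := by
  constructor
  · rintro hN C (hC | rfl)
    exacts [hN C hC, h hN]
  · exact fun hN C hC => hN C (Or.inl hC)

theorem evalLit_updP1_of_ne {M : Str} {ρ : PredAssign M.dom} {v : ℕ → M.dom} {X : ℕ}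
    {Q : List M.dom → Prop} {l : Lit} (h : ∀ ts, l.atom ≠ .pvar X ts) :
    evalLit M (updP1 ρ X Q) v l ↔ evalLit M ρ v l := by
  obtain ⟨b, _ | _ | ⟨Y, ts⟩⟩ := l
  · rfl
  · rfl
  · have hY : Y ≠ X := by rintro rfl; exact h ts rfl
    simp [evalLit, evalAtm, updP1, hY]

theorem clauseTrue_updP1_of_not_occursIn {M : Str} {ρ : PredAssign M.dom} {X : ℕ}
    {Q : List M.dom → Prop} {C : Clause} (h : ¬ OccursIn X C) :
    clauseTrue M (updP1 ρ X Q) C ↔ clauseTrue M ρ C :=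
  forall_congr' fun _ => exists_congr fun l => and_congr_right fun hl =>
    evalLit_updP1_of_ne fun ts hts => h ⟨l.pos, l, hl, rfl, ts, hts⟩

theorem clauseTrue_updP1_of_occursPol {M : Str} {ρ : PredAssign M.dom} {X : ℕ} {b : Bool}
    {C : Clause} (h : OccursPol X b C) : clauseTrue M (updP1 ρ X fun _ => b = true) C := by
  obtain ⟨⟨b, a⟩, hl, rfl, ts, rfl⟩ := h
  refine fun v => ⟨_, hl, ?_⟩
  cases b <;> simp [evalLit, evalAtm, updP1]

theorem setTrue_updP1_iff_of_extPure {M : Str} {ρ : PredAssign M.dom} {X : ℕ} {b : Bool}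
    {N : Set Clause} (h : ∀ C ∈ N, OccursIn X C → OccursPol X b C) :
    setTrue M (updP1 ρ X fun _ => b = true) N ↔ setTrue M ρ {C ∈ N | ¬ OccursIn X C} := by
  constructor
  · rintro hN C ⟨hC, hX⟩
    exact (clauseTrue_updP1_of_not_occursIn hX).1 (hN C hC)
  · intro hN C hC
    by_cases hX : OccursIn X C
    · exact clauseTrue_updP1_of_occursPol (h C hC hX)
    · exact (clauseTrue_updP1_of_not_occursIn hX).2 (hN C ⟨hC, hX⟩)

/-- If `S` is a 𝒞-derivation step from `N` to `N'` which is not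
a purified clause deletion step, then `N[X̄ ← T'_S] ⟺ N'` (the substitution being
taken semantically). -/
theorem transformation_equivalence_non_purdel
    {d : ℕ} (Xs : Fin d → ℕ) (hXs : Function.Injective Xs)
    (Red : Clause → Set Clause → Prop)
    (hRed₁ : RedCompat Red) (hRed₂ : RedEquiv Red)
    (N : Set Clause)
    (S : CStep) (hok : CStep.ok (Set.range Xs) Red N S)
    (hnp : ∀ P, S ≠ CStep.purDel P) :
    ∀ (M : Str) (ρ : PredAssign M.dom),
      setTrue M (updP ρ Xs (TPrime Xs S M ρ)) N ↔ setTrue M ρ (CStep.apply N S) := by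
  intro M ρ
  cases S with
  | res C D R =>
    obtain ⟨hC, hD, hR⟩ := hok
    simp only [TPrime, updP_apply_self]
    exact setTrue_union_singleton_iff fun hN v => hR.evalClause (hN C hC v) (hN D hD v)
  | fac C R =>
    obtain ⟨hC, hR⟩ := hok
    simp only [TPrime, updP_apply_self]
    exact setTrue_union_singleton_iff fun hN v => hR.evalClause (hN C hC v)
  | celim C R =>
    obtain ⟨hC, hR⟩ := hok
    simp only [TPrime, updP_apply_self]
    exact setTrue_union_singleton_iff fun hN => hR.clauseTrue (hN C hC)
  | redElim C =>
    simp only [TPrime, updP_apply_self]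
    exact (hRed₂ C N hok.1 hok.2 M ρ).symm
  | extPurDel X b =>
    simp only [TPrime, updP_ite_eq_updP1 ρ Xs hok.1]
    exact setTrue_updP1_iff_of_extPure hok.2
  | purDel P => exact absurd rfl (hnp P)

end Scan
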